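/- In the Hilbert system over 𝔏 consisting of all classical propositional tautologies, all instances of (B1) (□_Gφ ∧ □_Hψ) → □_{G∪H}(φ∧ψ) for disjoint finite nonempty G, H ⊆ I, and the necessitation axioms □_i⊤ for all i ∈ I, closed under modus ponens and replacement of equivalents (RE), all instances of the schemata (B2) □_{G∪H}⊤ → □_G⊤, (B3) (□_Gφ ∧ □_{G∪H∪J}φ) → □_{G∪H}φ, and (B4) (□_Gφ ∧ □_H(φ∨ψ)) → □_{G∪H}φ are theorems. -/

import Mathlib

attribute [local instance] Classical.propDecidable

/-- Formulas of the multi-modal language 𝔏: atoms, ⊥, ¬, ∨, and □_G for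
finite nonempty G ⊆ I. -/
inductive Form (I : Type) : Type
  | atom : ℕ → Form I
  | bot  : Form I
  | neg  : Form I → Form I
  | or   : Form I → Form I → Form I
  | box  : (G : Finset I) → G.Nonempty → Form I → Form I

namespace Form
variable {I : Type}
/-- φ ∧ ψ -/
def and (φ ψ : Form I) : Form I := .neg (.or (.neg φ) (.neg ψ))
/-- φ → ψ -/
def imp (φ ψ : Form I) : Form I := .or (.neg φ) ψ
/-- ⊤ -/
def top : Form I := .neg .bot
/-- φ ↔ ψ -/
def iff (φ ψ : Form I) : Form I := (φ.imp ψ).and (ψ.imp φ)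
end Form

/-- The pointwise-intersection neighbourhood function:
`N_G(w) = { ⋂_{i∈G} X_i : X_i ∈ N_i(w) }`. -/
def ptwInter {I W : Type} (N : I → W → Set (Set W)) (G : Finset I) (w : W) :
    Set (Set W) :=
  { X | ∃ Y : I → Set W, (∀ i ∈ G, Y i ∈ N i w) ∧ X = ⋂ i ∈ G, Y i }

/-- Satisfaction at a world, relative to neighbourhood functions `N` and a
valuation `V`. -/
def satN {I W : Type} (N : I → W → Set (Set W)) (V : ℕ → Set W) :
    Form I → W → Prop
  | .atom n, w => w ∈ V n
  | .bot, _ => False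
  | .neg φ, w => ¬ satN N V φ w
  | .or φ ψ, w => satN N V φ w ∨ satN N V ψ w
  | .box G _ φ, w => { v | satN N V φ v } ∈ ptwInter N G w

/-- A neighbourhood model. -/
structure NbhModel (I : Type) where
  W : Type
  ne : Nonempty W
  N : I → W → Set (Set W)
  V : ℕ → Set W

/-- Truth in a model. -/
def NbhModel.sat {I : Type} (M : NbhModel I) (w : M.W) (φ : Form I) : Prop :=
  satN M.N M.V φ w

/-- Propositional evaluation treating atoms and boxed formulas as atomic. -/
def evalP {I : Type} (v : Form I → Prop) : Form I → Prop
  | .atom n => v (.atom n)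
  | .bot => False
  | .neg φ => ¬ evalP v φ
  | .or φ ψ => evalP v φ ∨ evalP v ψ
  | .box G h φ => v (.box G h φ)

/-- Classical propositional tautologies (in the extended modal language). -/
def Tautology {I : Type} (φ : Form I) : Prop := ∀ v, evalP v φ

theorem unionNE {I : Type} [DecidableEq I] {G H : Finset I}
    (hG : G.Nonempty) : (G ∪ H).Nonempty :=
  hG.mono Finset.subset_union_left

/-- Axiom schema B1: `(□_Gφ ∧ □_Hψ) → □_{G∪H}(φ∧ψ)` for disjoint G, H. -/
def B1Ax (I : Type) [DecidableEq I] : Set (Form I) :=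
  { χ | ∃ (G H : Finset I) (hG : G.Nonempty) (hH : H.Nonempty) (φ ψ : Form I),
      Disjoint G H ∧
      χ = ((Form.box G hG φ).and (Form.box H hH ψ)).imp
            (Form.box (G ∪ H) (unionNE hG) (φ.and ψ)) }

/-- Axiom schema B2: `□_{G∪H}⊤ → □_G⊤`. -/
def B2Ax (I : Type) [DecidableEq I] : Set (Form I) :=
  { χ | ∃ (G H : Finset I) (hG : G.Nonempty) (_hH : H.Nonempty),
      χ = (Form.box (G ∪ H) (unionNE hG) Form.top).imp (Form.box G hG Form.top) }

/-- Axiom schema B3: `(□_Gφ ∧ □_{G∪H∪J}φ) → □_{G∪H}φ`. -/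
def B3Ax (I : Type) [DecidableEq I] : Set (Form I) :=
  { χ | ∃ (G H J : Finset I) (hG : G.Nonempty) (_hH : H.Nonempty)
      (_hJ : J.Nonempty) (φ : Form I),
      χ = ((Form.box G hG φ).and (Form.box (G ∪ H ∪ J) (unionNE (unionNE hG)) φ)).imp
            (Form.box (G ∪ H) (unionNE hG) φ) }

/-- Axiom schema B4: `(□_Gφ ∧ □_H(φ∨ψ)) → □_{G∪H}φ`. -/
def B4Ax (I : Type) [DecidableEq I] : Set (Form I) :=
  { χ | ∃ (G H : Finset I) (hG : G.Nonempty) (hH : H.Nonempty) (φ ψ : Form I),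
      χ = ((Form.box G hG φ).and (Form.box H hH (φ.or ψ))).imp
            (Form.box (G ∪ H) (unionNE hG) φ) }

/-- The axioms of the base logic. -/
def BaseAx (I : Type) [DecidableEq I] : Set (Form I) :=
  B1Ax I ∪ B2Ax I ∪ B3Ax I ∪ B4Ax I

/-- Hilbert-style provability from classical tautologies and the axioms in
`Ax`, closed under modus ponens and replacement of equivalents. -/
inductive Prv {I : Type} (Ax : Set (Form I)) : Form I → Prop
  | taut {φ : Form I} : Tautology φ → Prv Ax φ
  | ax {φ : Form I} : φ ∈ Ax → Prv Ax φ
  | mp {φ ψ : Form I} : Prv Ax (φ.imp ψ) → Prv Ax φ → Prv Ax ψ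
  | re {φ ψ : Form I} (G : Finset I) (hG : G.Nonempty) :
      Prv Ax (φ.iff ψ) → Prv Ax ((Form.box G hG φ).iff (Form.box G hG ψ))

/-- `Γ ⊢ φ` iff there are `ψ₁,…,ψₙ ∈ Γ` with `⊢ (ψ₁∧…∧ψₙ) → φ`. -/
def Deduces {I : Type} (Ax : Set (Form I)) (Γ : Set (Form I)) (φ : Form I) :
    Prop :=
  ∃ l : List (Form I), (∀ ψ ∈ l, ψ ∈ Γ) ∧
    Prv Ax ((l.foldr Form.and Form.top).imp φ)

/-- Semantic consequence over a class of models. -/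
def SemConseq {I : Type} (C : NbhModel I → Prop) (Γ : Set (Form I))
    (φ : Form I) : Prop :=
  ∀ M : NbhModel I, C M → ∀ w : M.W, (∀ ψ ∈ Γ, M.sat w ψ) → M.sat w φ

/-- Soundness and strong completeness of `Ax` w.r.t. the class `C`. -/
def SoundComplete {I : Type} (Ax : Set (Form I)) (C : NbhModel I → Prop) :
    Prop :=
  ∀ (Γ : Set (Form I)) (φ : Form I), Deduces Ax Γ φ ↔ SemConseq C Γ φ

/-- The necessitation axioms: □_i⊤ for all i ∈ I. -/
def NecAx (I : Type) : Set (Form I) :=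
  { χ | ∃ i : I, χ = Form.box {i} (Finset.singleton_nonempty i) Form.top }

namespace Prv
variable {I : Type} {Ax : Set (Form I)} {φ ψ χ : Form I}

theorem imp_trans (h₁ : Prv Ax (φ.imp ψ)) (h₂ : Prv Ax (ψ.imp χ)) : Prv Ax (φ.imp χ) := by
  refine mp (mp (taut (φ := (φ.imp ψ).imp ((ψ.imp χ).imp (φ.imp χ))) ?_) h₁) h₂
  intro v
  simp only [Form.imp, evalP]
  tauto

theorem iff_mp (h : Prv Ax (φ.iff ψ)) : Prv Ax (φ.imp ψ) := by
  refine mp (taut (φ := (φ.iff ψ).imp (φ.imp ψ)) ?_) h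
  intro v
  simp only [Form.iff, Form.and, Form.imp, evalP]
  tauto

theorem imp_of_right (h : Prv Ax ψ) : Prv Ax (φ.imp ψ) := by
  refine mp (taut (φ := ψ.imp (φ.imp ψ)) ?_) h
  intro v
  simp only [Form.imp, evalP]
  tauto

theorem and_imp_of_left (h : Prv Ax (φ.imp χ)) : Prv Ax ((φ.and ψ).imp χ) := by
  refine mp (taut (φ := (φ.imp χ).imp ((φ.and ψ).imp χ)) ?_) h
  intro v
  simp only [Form.and, Form.imp, evalP]
  tauto

theorem imp_of_and_imp (h : Prv Ax ((φ.and ψ).imp χ)) (hψ : Prv Ax ψ) : Prv Ax (φ.imp χ) := by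
  refine mp (mp (taut (φ := ((φ.and ψ).imp χ).imp (ψ.imp (φ.imp χ))) ?_) h) hψ
  intro v
  simp only [Form.and, Form.imp, evalP]
  tauto

theorem and_top_iff : Prv Ax ((φ.and Form.top).iff φ) := by
  refine taut fun v => ?_
  simp only [Form.iff, Form.and, Form.imp, Form.top, evalP]
  tauto

variable [DecidableEq I]

/-- Adding a disjoint group whose members all accept `⊤` preserves `□φ`. -/
theorem box_imp_box_union (hAx : B1Ax I ⊆ Ax) {G H K : Finset I} (hG : G.Nonempty)
    (hH : H.Nonempty) (hK : K.Nonempty) (hdisj : Disjoint G H) (hGHK : G ∪ H = K)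
    (hTop : Prv Ax (Form.box H hH Form.top)) :
    Prv Ax ((Form.box G hG φ).imp (Form.box K hK φ)) := by
  subst hGHK
  refine imp_trans (imp_of_and_imp (ax (hAx ?_)) hTop) (iff_mp (re _ hK and_top_iff))
  refine ⟨G, H, hG, hH, φ, Form.top, hdisj, ?_⟩
  congr!

theorem box_top (hB1 : B1Ax I ⊆ Ax) (hNec : NecAx I ⊆ Ax) (G : Finset I) (hG : G.Nonempty) :
    Prv Ax (Form.box G hG Form.top) := by
  induction hG using Finset.Nonempty.cons_induction with
  | singleton i => exact ax (hNec ⟨i, rfl⟩)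
  | cons i s hi hs ih =>
    refine mp (box_imp_box_union hB1 hs (Finset.singleton_nonempty i) _ ?_ ?_
      (ax (hNec ⟨i, rfl⟩))) ih
    · simpa using hi
    · ext x
      simp

/-- With B1 and necessitation, `□_Gφ` is monotone in the group `G`. -/
theorem box_imp_box_of_subset (hB1 : B1Ax I ⊆ Ax) (hNec : NecAx I ⊆ Ax) {G K : Finset I}
    (hG : G.Nonempty) (hK : K.Nonempty) (hGK : G ⊆ K) :
    Prv Ax ((Form.box G hG φ).imp (Form.box K hK φ)) := by
  rcases (K \ G).eq_empty_or_nonempty with h | h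
  · obtain rfl : G = K := hGK.antisymm (Finset.sdiff_eq_empty_iff_subset.mp h)
    exact taut fun v => by simp only [Form.imp, evalP]; tauto
  · exact box_imp_box_union hB1 hG h hK Finset.disjoint_sdiff
      (Finset.union_sdiff_of_subset hGK) (box_top hB1 hNec _ h)

end Prv

/-- In the Hilbert system with classical tautologies, B1 and
the necessitation axioms □_i⊤ (closed under MP and RE), all instances of
B2, B3 and B4 are theorems. -/
theorem B234_derivable (I : Type) [DecidableEq I] (χ : Form I)
    (hχ : χ ∈ B2Ax I ∪ B3Ax I ∪ B4Ax I) :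
    Prv (B1Ax I ∪ NecAx I) χ := by
  have hB1 : B1Ax I ⊆ B1Ax I ∪ NecAx I := Set.subset_union_left
  have hNec : NecAx I ⊆ B1Ax I ∪ NecAx I := Set.subset_union_right
  rcases hχ with (⟨G, H, hG, -, rfl⟩ | ⟨G, H, J, hG, -, -, φ, rfl⟩) | ⟨G, H, hG, hH, φ, ψ, rfl⟩
  · exact .imp_of_right (.box_top hB1 hNec G hG)
  · exact .and_imp_of_left (.box_imp_box_of_subset hB1 hNec hG _ Finset.subset_union_left)
  · exact .and_imp_of_left (.box_imp_box_of_subset hB1 hNec hG _ Finset.subset_union_left)
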